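/- Let k ≥ 2 be an integer. Then {div τ : τ ∈ Σ_{K,b}} = V_{K,⊥}, where V_{K,⊥} is the set of P_{k−1} vector fields v satisfying ∫_K v(x) · r(x) dx = 0 for every rigid motion r. In particular, for every P_{k−1} vector field v that is L²(K)-orthogonal to all rigid motions, there exist p₀, p₁, p₂ ∈ P_{k−2} such that div(λ₂λ₀ p₁ n₁⊥(n₁⊥)ᵀ + λ₀λ₁ p₂ n₂⊥(n₂⊥)ᵀ + λ₁λ₂ p₀ n₀⊥(n₀⊥)ᵀ) = v identically on ℝ². -/

import Mathlib

open MeasureTheory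

noncomputable section

/-- For a column vector `v ∈ ℝ²`, `vvT v` is the rank-one symmetric matrix `v vᵀ`. -/
def vvT (v : Fin 2 → ℝ) : Matrix (Fin 2) (Fin 2) ℝ :=
  Matrix.of fun i j => v i * v j

/-- For `n = (a, b)`, `perp n = (−b, a)`. -/
def perp (n : Fin 2 → ℝ) : Fin 2 → ℝ := ![-(n 1), n 0]

/-- Frobenius inner product `A : B` of 2×2 matrices. -/
def frob (A B : Matrix (Fin 2) (Fin 2) ℝ) : ℝ :=
  ∑ i : Fin 2, ∑ j : Fin 2, A i j * B i j

/-- Partial derivative in the `i`-th coordinate direction. -/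
def pd (i : Fin 2) (f : (Fin 2 → ℝ) → ℝ) : (Fin 2 → ℝ) → ℝ :=
  fun x => fderiv ℝ f x (Pi.single i 1)

/-- Row-wise divergence of a matrix field: `(div τ)_i = ∂τ_{i1}/∂x + ∂τ_{i2}/∂y`. -/
def matDiv (τ : (Fin 2 → ℝ) → Matrix (Fin 2) (Fin 2) ℝ) : (Fin 2 → ℝ) → Fin 2 → ℝ :=
  fun x i => pd 0 (fun y => τ y i 0) x + pd 1 (fun y => τ y i 1) x

/-- Symmetric gradient `ε(v) = (Dv + (Dv)ᵀ)/2` of a vector field. -/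
def symGrad (v : (Fin 2 → ℝ) → Fin 2 → ℝ) : (Fin 2 → ℝ) → Matrix (Fin 2) (Fin 2) ℝ :=
  fun x => Matrix.of fun i j => (pd j (fun y => v y i) x + pd i (fun y => v y j) x) / 2

/-- A rigid motion `(x, y) ↦ (a − by, c + bx)`. -/
def IsRigidMotion (r : (Fin 2 → ℝ) → Fin 2 → ℝ) : Prop :=
  ∃ a b c : ℝ, ∀ x, r x = ![a - b * x 1, c + b * x 0]

/-- `f : ℝ² → ℝ` is a polynomial function of total degree at most `m`
(the zero space when `m < 0`). -/
def IsPolyDeg (m : ℤ) (f : (Fin 2 → ℝ) → ℝ) : Prop :=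
  ∃ p : MvPolynomial (Fin 2) ℝ, (∀ x, f x = MvPolynomial.eval x p) ∧
    ((p.totalDegree : ℤ) ≤ m ∨ p = 0)

/-- `f : ℝ² → ℝ` is an affine function. -/
def IsAffineFn (f : (Fin 2 → ℝ) → ℝ) : Prop :=
  ∃ (w : Fin 2 → ℝ) (c : ℝ), ∀ x, f x = w 0 * x 0 + w 1 * x 1 + c

/-- The triangle `K` with the given vertices. -/
def Ktri (x0 x1 x2 : Fin 2 → ℝ) : Set (Fin 2 → ℝ) :=
  convexHull ℝ {x0, x1, x2}

/-- The matrix whose columns are `x1 − x0` and `x2 − x0`. -/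
def Bmat (x0 x1 x2 : Fin 2 → ℝ) : Matrix (Fin 2) (Fin 2) ℝ :=
  Matrix.of fun i j => if j = 0 then x1 i - x0 i else x2 i - x0 i

/-- `nvec x0 x1 x2 1` and `nvec x0 x1 x2 2` are the rows of `(Bmat x0 x1 x2)⁻¹`,
and `nvec x0 x1 x2 0 = −n₁ − n₂`. -/
def nvec (x0 x1 x2 : Fin 2 → ℝ) : Fin 3 → Fin 2 → ℝ :=
  ![fun j => -((Bmat x0 x1 x2)⁻¹ 0 j) - (Bmat x0 x1 x2)⁻¹ 1 j,
    fun j => (Bmat x0 x1 x2)⁻¹ 0 j,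
    fun j => (Bmat x0 x1 x2)⁻¹ 1 j]

/-- The bubble stress `λ₂λ₀ p₁ n₁⊥(n₁⊥)ᵀ + λ₀λ₁ p₂ n₂⊥(n₂⊥)ᵀ + λ₁λ₂ p₀ n₀⊥(n₀⊥)ᵀ`. -/
def bubbleStress (x0 x1 x2 : Fin 2 → ℝ) (lam : Fin 3 → (Fin 2 → ℝ) → ℝ)
    (p : Fin 3 → (Fin 2 → ℝ) → ℝ) : (Fin 2 → ℝ) → Matrix (Fin 2) (Fin 2) ℝ :=
  fun x => (lam 2 x * lam 0 x * p 1 x) • vvT (perp (nvec x0 x1 x2 1))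
         + (lam 0 x * lam 1 x * p 2 x) • vvT (perp (nvec x0 x1 x2 2))
         + (lam 1 x * lam 2 x * p 0 x) • vvT (perp (nvec x0 x1 x2 0))

/-- Membership in the local bubble stress space `Σ_{K,b}` of order `k`. -/
def SigmaKb (k : ℕ) (x0 x1 x2 : Fin 2 → ℝ) (lam : Fin 3 → (Fin 2 → ℝ) → ℝ)
    (τ : (Fin 2 → ℝ) → Matrix (Fin 2) (Fin 2) ℝ) : Prop :=
  ∃ p : Fin 3 → (Fin 2 → ℝ) → ℝ,
    (∀ i, IsPolyDeg ((k : ℤ) - 2) (p i)) ∧ τ = bubbleStress x0 x1 x2 lam p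

open MvPolynomial in
lemma hasFDerivAt_eval (p : MvPolynomial (Fin 2) ℝ) (x : Fin 2 → ℝ) :
    HasFDerivAt (fun y => eval y p)
      (∑ i, eval x (pderiv i p) • ContinuousLinearMap.proj (R := ℝ) (φ := fun _ : Fin 2 => ℝ) i)
      x := by
  induction p using MvPolynomial.induction_on with
  | C a => simpa using hasFDerivAt_const a x
  | add p q hp hq =>
    simp only [map_add, add_smul, Finset.sum_add_distrib]
    exact hp.add hq
  | mul_X p j hp =>
    simp only [map_mul, eval_X]
    refine (hp.mul (hasFDerivAt_apply j x)).congr_fderiv ?_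
    ext v
    fin_cases j <;> simp [pderiv_X] <;> ring

lemma pd_eval (i : Fin 2) (p : MvPolynomial (Fin 2) ℝ) (x : Fin 2 → ℝ) :
    pd i (fun y => MvPolynomial.eval y p) x = MvPolynomial.eval x (MvPolynomial.pderiv i p) := by
  unfold pd
  rw [(hasFDerivAt_eval p x).fderiv]
  fin_cases i <;> simp

lemma totalDegree_pderiv_le {m : ℕ} (i : Fin 2) {p : MvPolynomial (Fin 2) ℝ}
    (hp : p.totalDegree ≤ m + 1) : (MvPolynomial.pderiv i p).totalDegree ≤ m := by
  refine Finset.sup_le fun s hs => ?_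
  rw [MvPolynomial.mem_support_iff, MvPolynomial.coeff_pderiv] at hs
  have h := MvPolynomial.le_totalDegree
    (MvPolynomial.mem_support_iff.2 (left_ne_zero_of_mul hs))
  have h2 : (s + Finsupp.single i 1).sum (fun _ e => e) = (s.sum fun _ e => e) + 1 := by
    rw [Finsupp.sum_add_index' (by simp) (by simp)]
    simp
  omega

lemma eq_zero_of_eval_eq_zero_on_open {p : MvPolynomial (Fin 2) ℝ} {s : Set (Fin 2 → ℝ)}
    (hs : IsOpen s) (hne : s.Nonempty) (h : ∀ x ∈ s, MvPolynomial.eval x p = 0) : p = 0 := by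
  obtain ⟨x, hx⟩ := hne
  obtain ⟨r, hr, hsub⟩ := Metric.isOpen_iff.1 hs x hx
  refine MvPolynomial.funext_set (fun i => Metric.ball (x i) r)
    (fun i => infinite_of_mem_nhds (x i) (Metric.ball_mem_nhds _ hr)) fun y hy => ?_
  rw [map_zero]
  exact h y (hsub (by rwa [ball_pi x hr]))

lemma exists_eq_C_of_pderiv_eq_zero {p : MvPolynomial (Fin 2) ℝ}
    (h : ∀ i, MvPolynomial.pderiv i p = 0) : ∃ a, p = MvPolynomial.C a := by
  refine ⟨MvPolynomial.eval 0 p, MvPolynomial.funext fun x => ?_⟩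
  rw [MvPolynomial.eval_C]
  refine is_const_of_fderiv_eq_zero (𝕜 := ℝ) (f := fun y => MvPolynomial.eval y p)
    (fun y => (hasFDerivAt_eval p y).differentiableAt) (fun y => ?_) x 0
  rw [(hasFDerivAt_eval p y).fderiv]
  simp [h]

/-- The derivative of polynomials in the direction `t`. -/
def dirDeriv (t : Fin 2 → ℝ) :
    Derivation ℝ (MvPolynomial (Fin 2) ℝ) (MvPolynomial (Fin 2) ℝ) :=
  t 0 • MvPolynomial.pderiv 0 + t 1 • MvPolynomial.pderiv 1

lemma dirDeriv_apply (t : Fin 2 → ℝ) (p : MvPolynomial (Fin 2) ℝ) :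
    dirDeriv t p = t 0 • MvPolynomial.pderiv 0 p + t 1 • MvPolynomial.pderiv 1 p := rfl

lemma dirDeriv_smul (c : ℝ) (t : Fin 2 → ℝ) (p : MvPolynomial (Fin 2) ℝ) :
    dirDeriv (c • t) p = c • dirDeriv t p := by
  simp [dirDeriv_apply, mul_smul]

lemma totalDegree_dirDeriv_le {m : ℕ} (t : Fin 2 → ℝ) {p : MvPolynomial (Fin 2) ℝ}
    (hp : p.totalDegree ≤ m + 1) : (dirDeriv t p).totalDegree ≤ m := by
  rw [dirDeriv_apply, ← MvPolynomial.mem_restrictTotalDegree]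
  refine add_mem (Submodule.smul_mem _ _ ?_) (Submodule.smul_mem _ _ ?_) <;>
    exact (MvPolynomial.mem_restrictTotalDegree _ _ _).2 (totalDegree_pderiv_le _ hp)

/-- The component of a polynomial vector field in the direction `t`. -/
def tanComp (t : Fin 2 → ℝ) (w : Fin 2 → MvPolynomial (Fin 2) ℝ) : MvPolynomial (Fin 2) ℝ :=
  t 0 • w 0 + t 1 • w 1

/-- The rigid motion `(x, y) ↦ (a − by, c + bx)` as a polynomial vector field. -/
def rigidPoly (a b c : ℝ) : Fin 2 → MvPolynomial (Fin 2) ℝ :=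
  ![MvPolynomial.C a - MvPolynomial.C b * MvPolynomial.X 1,
    MvPolynomial.C c + MvPolynomial.C b * MvPolynomial.X 0]

lemma dirDeriv_tanComp_rigidPoly (t : Fin 2 → ℝ) (a b c : ℝ) :
    dirDeriv t (tanComp t (rigidPoly a b c)) = 0 := by
  apply MvPolynomial.funext
  intro x
  simp [dirDeriv_apply, tanComp, rigidPoly, MvPolynomial.pderiv_X]
  ring

lemma exists_eq_rigidPoly {w : Fin 2 → MvPolynomial (Fin 2) ℝ}
    (h00 : MvPolynomial.pderiv 0 (w 0) = 0) (h11 : MvPolynomial.pderiv 1 (w 1) = 0)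
    (h01 : MvPolynomial.pderiv 1 (w 0) + MvPolynomial.pderiv 0 (w 1) = 0) :
    ∃ a b c, w = rigidPoly a b c := by
  have comm (p : MvPolynomial (Fin 2) ℝ) : MvPolynomial.pderiv 0 (MvPolynomial.pderiv 1 p) =
      MvPolynomial.pderiv 1 (MvPolynomial.pderiv 0 p) := by
    ext s
    simp only [MvPolynomial.coeff_pderiv]
    rw [add_right_comm]
    simp
    ring
  have e : MvPolynomial.pderiv 0 (w 1) = - MvPolynomial.pderiv 1 (w 0) :=
    eq_neg_of_add_eq_zero_right h01
  obtain ⟨b, hb⟩ : ∃ b, MvPolynomial.pderiv 0 (w 1) = MvPolynomial.C b := by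
    refine exists_eq_C_of_pderiv_eq_zero (Fin.forall_fin_two.2 ⟨?_, ?_⟩)
    · rw [e, map_neg, comm, h00, map_zero, neg_zero]
    · rw [← comm, h11, map_zero]
  have hb' : MvPolynomial.pderiv 1 (w 0) = - MvPolynomial.C b := by rw [← hb, e, neg_neg]
  obtain ⟨a, ha⟩ := exists_eq_C_of_pderiv_eq_zero
    (p := w 0 + MvPolynomial.C b * MvPolynomial.X 1)
    (Fin.forall_fin_two.2 ⟨by simp [h00, MvPolynomial.pderiv_X],
      by simp [hb', MvPolynomial.pderiv_X]⟩)
  obtain ⟨c, hc⟩ := exists_eq_C_of_pderiv_eq_zero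
    (p := w 1 - MvPolynomial.C b * MvPolynomial.X 0)
    (Fin.forall_fin_two.2 ⟨by simp [hb, MvPolynomial.pderiv_X],
      by simp [h11, MvPolynomial.pderiv_X]⟩)
  refine ⟨a, b, c, funext (Fin.forall_fin_two.2 ⟨?_, ?_⟩)⟩
  · exact eq_sub_of_add_eq ha
  · exact eq_add_of_sub_eq hc

/-- If the symmetric gradient vanishes along two independent directions and their sum, then the
field is a rigid motion. -/
lemma exists_eq_rigidPoly_of_dirDeriv {w : Fin 2 → MvPolynomial (Fin 2) ℝ} {s u : Fin 2 → ℝ}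
    (hd : s 0 * u 1 - s 1 * u 0 ≠ 0)
    (hs : dirDeriv s (tanComp s w) = 0) (hu : dirDeriv u (tanComp u w) = 0)
    (hsu : dirDeriv (s + u) (tanComp (s + u) w) = 0) :
    ∃ a b c, w = rigidPoly a b c := by
  have key (x : Fin 2 → ℝ) :
      MvPolynomial.eval x (MvPolynomial.pderiv 0 (w 0)) = 0 ∧
      MvPolynomial.eval x (MvPolynomial.pderiv 1 (w 1)) = 0 ∧
      MvPolynomial.eval x (MvPolynomial.pderiv 1 (w 0) + MvPolynomial.pderiv 0 (w 1)) = 0 := by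
    replace hs := congrArg (MvPolynomial.eval x) hs
    replace hu := congrArg (MvPolynomial.eval x) hu
    replace hsu := congrArg (MvPolynomial.eval x) hsu
    simp only [dirDeriv_apply, tanComp, map_add, map_zero, Derivation.map_smul,
      MvPolynomial.smul_eval, Pi.add_apply] at hs hu hsu ⊢
    have hd2 := pow_ne_zero 2 hd
    refine ⟨mul_left_cancel₀ hd2 ?_, mul_left_cancel₀ hd2 ?_, mul_left_cancel₀ hd2 ?_⟩
    · linear_combination (u 1 ^ 2 + s 1 * u 1) * hs + (s 1 ^ 2 + s 1 * u 1) * hu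
        - s 1 * u 1 * hsu
    · linear_combination (u 0 ^ 2 + s 0 * u 0) * hs + (s 0 ^ 2 + s 0 * u 0) * hu
        - s 0 * u 0 * hsu
    · linear_combination (-2 * u 0 * u 1 - (s 0 * u 1 + s 1 * u 0)) * hs
        + (-2 * s 0 * s 1 - (s 0 * u 1 + s 1 * u 0)) * hu
        + (s 0 * u 1 + s 1 * u 0) * hsu
  refine exists_eq_rigidPoly (MvPolynomial.funext fun x => ?_) (MvPolynomial.funext fun x => ?_)
    (MvPolynomial.funext fun x => ?_) <;> rw [map_zero]
  exacts [(key x).1, (key x).2.1, (key x).2.2]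

lemma exists_sub_orthogonal {V : Type*} [AddCommGroup V] [Module ℝ V] (B : V →ₗ[ℝ] V →ₗ[ℝ] ℝ)
    (U : Submodule ℝ V) [FiniteDimensional ℝ U] (hB : ∀ u ∈ U, B u u = 0 → u = 0) (v : V) :
    ∃ u ∈ U, ∀ w ∈ U, B (v - u) w = 0 := by
  let T : U →ₗ[ℝ] Module.Dual ℝ U := (LinearMap.lcomp ℝ ℝ U.subtype) ∘ₗ B ∘ₗ U.subtype
  have hinj : Function.Injective T := by
    rw [← LinearMap.ker_eq_bot, LinearMap.ker_eq_bot']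
    intro u hu
    exact Subtype.ext (hB u u.2 (LinearMap.congr_fun hu u))
  have hsurj := (LinearMap.injective_iff_surjective_of_finrank_eq_finrank
    (Subspace.dual_finrank_eq (K := ℝ) (V := U)).symm).1 hinj
  obtain ⟨u, hu⟩ := hsurj ((B v).comp U.subtype)
  refine ⟨u, u.2, fun w hw => ?_⟩
  have h : B u w = B v w := LinearMap.congr_fun hu ⟨w, hw⟩
  rw [map_sub, LinearMap.sub_apply, h, sub_self]

/-- The bubble divergence operator `p ↦ ∑ₗ div (φₗ pₗ tₗ tₗᵀ)` on polynomials. -/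
def bubbleDiv (t : Fin 3 → Fin 2 → ℝ) (φ : Fin 3 → MvPolynomial (Fin 2) ℝ) :
    (Fin 3 → MvPolynomial (Fin 2) ℝ) →ₗ[ℝ] (Fin 2 → MvPolynomial (Fin 2) ℝ) where
  toFun p i := ∑ l, t l i • dirDeriv (t l) (φ l * p l)
  map_add' p q := by
    funext i
    simp [mul_add, smul_add, Finset.sum_add_distrib]
  map_smul' c p := by
    funext i
    simp [Finset.smul_sum, smul_comm c]

lemma bubbleDiv_apply (t : Fin 3 → Fin 2 → ℝ) (φ p : Fin 3 → MvPolynomial (Fin 2) ℝ) (i : Fin 2) :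
    bubbleDiv t φ p i = ∑ l, t l i • dirDeriv (t l) (φ l * p l) := rfl

lemma totalDegree_bubbleDiv_le {m : ℕ} (t : Fin 3 → Fin 2 → ℝ)
    {φ p : Fin 3 → MvPolynomial (Fin 2) ℝ} (hφ : ∀ l, (φ l).totalDegree ≤ 2)
    (hp : ∀ l, (p l).totalDegree ≤ m) (i : Fin 2) :
    (bubbleDiv t φ p i).totalDegree ≤ m + 1 := by
  rw [bubbleDiv_apply, ← MvPolynomial.mem_restrictTotalDegree]
  refine Submodule.sum_mem _ fun l _ => Submodule.smul_mem _ _ ?_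
  refine (MvPolynomial.mem_restrictTotalDegree _ _ _).2 (totalDegree_dirDeriv_le _ ?_)
  have := MvPolynomial.totalDegree_mul (φ l) (p l)
  have := hφ l
  have := hp l
  omega

/-- The bilinear form `(u, w) ↦ I (u · w)` on polynomial vector fields. -/
def fieldForm (I : MvPolynomial (Fin 2) ℝ →ₗ[ℝ] ℝ) :
    (Fin 2 → MvPolynomial (Fin 2) ℝ) →ₗ[ℝ] (Fin 2 → MvPolynomial (Fin 2) ℝ) →ₗ[ℝ] ℝ :=
  LinearMap.mk₂ ℝ (fun u w => I (u 0 * w 0 + u 1 * w 1))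
    (fun u u' w => by rw [← map_add]; congr 1; simp only [Pi.add_apply]; ring)
    (fun c u w => by
      rw [← map_smul]; congr 1
      simp only [Pi.smul_apply, smul_mul_assoc, smul_add])
    (fun u w w' => by rw [← map_add]; congr 1; simp only [Pi.add_apply]; ring)
    (fun c u w => by
      rw [← map_smul]; congr 1
      simp only [Pi.smul_apply, mul_smul_comm, smul_add])

lemma fieldForm_apply (I : MvPolynomial (Fin 2) ℝ →ₗ[ℝ] ℝ) (u w : Fin 2 → MvPolynomial (Fin 2) ℝ) :
    fieldForm I u w = I (u 0 * w 0 + u 1 * w 1) := rfl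

lemma fieldForm_bubbleDiv {I : MvPolynomial (Fin 2) ℝ →ₗ[ℝ] ℝ} {t : Fin 3 → Fin 2 → ℝ}
    {φ : Fin 3 → MvPolynomial (Fin 2) ℝ} (hI : ∀ l q, I (dirDeriv (t l) (φ l * q)) = 0)
    (p : Fin 3 → MvPolynomial (Fin 2) ℝ) (w : Fin 2 → MvPolynomial (Fin 2) ℝ) :
    fieldForm I (bubbleDiv t φ p) w =
      - ∑ l, I (φ l * p l * dirDeriv (t l) (tanComp (t l) w)) := by
  have h (l : Fin 3) : I (φ l * p l * dirDeriv (t l) (tanComp (t l) w)) =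
      - I (tanComp (t l) w * dirDeriv (t l) (φ l * p l)) := by
    have := hI l (p l * tanComp (t l) w)
    rw [← mul_assoc, Derivation.leibniz, map_add, smul_eq_mul, smul_eq_mul] at this
    linarith
  simp only [h, Finset.sum_neg_distrib, neg_neg]
  rw [fieldForm_apply, ← map_sum]
  congr 1
  simp only [bubbleDiv_apply, tanComp, Fin.sum_univ_three, MvPolynomial.smul_eq_C_mul]
  ring

lemma fieldForm_bubbleDiv_rigidPoly {I : MvPolynomial (Fin 2) ℝ →ₗ[ℝ] ℝ} {t : Fin 3 → Fin 2 → ℝ}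
    {φ : Fin 3 → MvPolynomial (Fin 2) ℝ} (hI : ∀ l q, I (dirDeriv (t l) (φ l * q)) = 0)
    (p : Fin 3 → MvPolynomial (Fin 2) ℝ) (a b c : ℝ) :
    fieldForm I (bubbleDiv t φ p) (rigidPoly a b c) = 0 := by
  simp [fieldForm_bubbleDiv hI, dirDeriv_tanComp_rigidPoly]

lemma eq_zero_of_fieldForm_self {I : MvPolynomial (Fin 2) ℝ →ₗ[ℝ] ℝ}
    (hI_nonneg : ∀ p, 0 ≤ I (p ^ 2)) (hI_def : ∀ p, I (p ^ 2) = 0 → p = 0)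
    {u : Fin 2 → MvPolynomial (Fin 2) ℝ} (h : fieldForm I u u = 0) : u = 0 := by
  rw [fieldForm_apply, ← pow_two, ← pow_two, map_add] at h
  have h0 := hI_nonneg (u 0)
  have h1 := hI_nonneg (u 1)
  refine funext (Fin.forall_fin_two.2 ⟨hI_def _ ?_, hI_def _ ?_⟩) <;> linarith

/-- Surjectivity of the bubble divergence onto the fields orthogonal to rigid motions, for an
abstract positive integration functional satisfying integration by parts. -/
lemma exists_bubbleDiv_eq {m : ℕ} {I : MvPolynomial (Fin 2) ℝ →ₗ[ℝ] ℝ} {t : Fin 3 → Fin 2 → ℝ}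
    {φ : Fin 3 → MvPolynomial (Fin 2) ℝ} (hI : ∀ l q, I (dirDeriv (t l) (φ l * q)) = 0)
    (hφ : ∀ l, (φ l).totalDegree ≤ 2)
    (hφ_nonneg : ∀ l p, 0 ≤ I (φ l * p ^ 2)) (hφ_def : ∀ l p, I (φ l * p ^ 2) = 0 → p = 0)
    (hI_nonneg : ∀ p, 0 ≤ I (p ^ 2)) (hI_def : ∀ p, I (p ^ 2) = 0 → p = 0)
    (ht : t 1 0 * t 2 1 - t 1 1 * t 2 0 ≠ 0) (ht0 : t 0 = -(t 1 + t 2))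
    {v : Fin 2 → MvPolynomial (Fin 2) ℝ} (hv : ∀ i, (v i).totalDegree ≤ m + 1)
    (hvr : ∀ a b c, fieldForm I v (rigidPoly a b c) = 0) :
    ∃ p : Fin 3 → MvPolynomial (Fin 2) ℝ, (∀ l, (p l).totalDegree ≤ m) ∧ bubbleDiv t φ p = v := by
  let S : (Fin 3 → MvPolynomial.restrictTotalDegree (Fin 2) ℝ m) →ₗ[ℝ]
      (Fin 2 → MvPolynomial (Fin 2) ℝ) :=
    bubbleDiv t φ ∘ₗ LinearMap.compLeft
      (MvPolynomial.restrictTotalDegree (Fin 2) ℝ m).subtype (Fin 3)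
  obtain ⟨u, ⟨q, hq⟩, hu⟩ := exists_sub_orthogonal (fieldForm I) (LinearMap.range S)
    (fun u _ => eq_zero_of_fieldForm_self hI_nonneg hI_def) v
  replace hq : bubbleDiv t φ (fun l => (q l : MvPolynomial (Fin 2) ℝ)) = u := hq
  have hqdeg (l : Fin 3) : (q l : MvPolynomial (Fin 2) ℝ).totalDegree ≤ m :=
    (MvPolynomial.mem_restrictTotalDegree _ _ _).1 (q l).2
  refine ⟨_, hqdeg, ?_⟩
  rw [hq]
  have hwdeg (i : Fin 2) : v i - u i ∈ MvPolynomial.restrictTotalDegree (Fin 2) ℝ (m + 1) := by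
    refine sub_mem ((MvPolynomial.mem_restrictTotalDegree _ _ _).2 (hv i))
      ((MvPolynomial.mem_restrictTotalDegree _ _ _).2 ?_)
    rw [← hq]
    exact totalDegree_bubbleDiv_le t hφ hqdeg i
  set w := v - u with hw
  have hpdeg (l : Fin 3) : dirDeriv (t l) (tanComp (t l) w) ∈
      MvPolynomial.restrictTotalDegree (Fin 2) ℝ m := by
    refine (MvPolynomial.mem_restrictTotalDegree _ _ _).2 (totalDegree_dirDeriv_le _ ?_)
    rw [← MvPolynomial.mem_restrictTotalDegree]
    exact add_mem (Submodule.smul_mem _ _ (hwdeg 0)) (Submodule.smul_mem _ _ (hwdeg 1))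
  have horth := hu _ ⟨fun l => ⟨_, hpdeg l⟩, rfl⟩
  have hsymm (a b) : fieldForm I a b = fieldForm I b a := by
    simp only [fieldForm_apply, mul_comm]
  rw [hsymm] at horth
  replace horth := (fieldForm_bubbleDiv hI _ w).symm.trans horth
  have hzero (l : Fin 3) : dirDeriv (t l) (tanComp (t l) w) = 0 := by
    apply hφ_def l
    rw [neg_eq_zero, Finset.sum_eq_zero_iff_of_nonneg] at horth
    · rw [pow_two, ← mul_assoc]
      exact horth l (Finset.mem_univ l)
    · intro l _
      have := hφ_nonneg l (dirDeriv (t l) (tanComp (t l) w))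
      rwa [pow_two, ← mul_assoc] at this
  have h12 : dirDeriv (t 1 + t 2) (tanComp (t 1 + t 2) w) = 0 := by
    have h := hzero 0
    rw [ht0] at h
    rw [← h]
    simp only [dirDeriv_apply, tanComp, Pi.neg_apply, MvPolynomial.smul_eq_C_mul, map_neg, map_add,
      Derivation.leibniz, MvPolynomial.pderiv_C]
    simp only [smul_eq_mul]
    ring
  obtain ⟨a, b, c, hr⟩ := exists_eq_rigidPoly_of_dirDeriv ht (hzero 1) (hzero 2) h12
  have hww : fieldForm I w w = 0 := by
    nth_rewrite 2 [hr]
    rw [hw, map_sub, LinearMap.sub_apply, hvr, ← hq, fieldForm_bubbleDiv_rigidPoly hI, sub_zero]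
  exact (sub_eq_zero.1 (eq_zero_of_fieldForm_self hI_nonneg hI_def hww)).symm

lemma isCompact_Ktri (a b c : Fin 2 → ℝ) : IsCompact (Ktri a b c) :=
  (Set.toFinite ({a, b, c} : Set (Fin 2 → ℝ))).isCompact_convexHull ℝ

lemma integrableOn_eval_Ktri (a b c : Fin 2 → ℝ) (p : MvPolynomial (Fin 2) ℝ) :
    IntegrableOn (fun x => MvPolynomial.eval x p) (Ktri a b c) :=
  (MvPolynomial.continuous_eval p).continuousOn.integrableOn_compact (isCompact_Ktri a b c)

/-- Integration of polynomials over a triangle, as a linear functional. -/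
def triIntegral (a b c : Fin 2 → ℝ) : MvPolynomial (Fin 2) ℝ →ₗ[ℝ] ℝ where
  toFun p := ∫ x in Ktri a b c, MvPolynomial.eval x p
  map_add' p q := by
    simp only [map_add]
    exact integral_add (integrableOn_eval_Ktri a b c p) (integrableOn_eval_Ktri a b c q)
  map_smul' r p := by
    simp only [MvPolynomial.smul_eval, RingHom.id_apply, smul_eq_mul]
    exact integral_const_mul _ _

lemma triIntegral_apply (a b c : Fin 2 → ℝ) (p : MvPolynomial (Fin 2) ℝ) :
    triIntegral a b c p = ∫ x in Ktri a b c, MvPolynomial.eval x p := rfl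

/-- The affine parametrization of the triangle with vertices `a`, `b`, `c`. -/
def triParam (a b c : Fin 2 → ℝ) (y : Fin 2 → ℝ) : Fin 2 → ℝ :=
  a + y 0 • (b - a) + y 1 • (c - a)

/-- The reference triangle. -/
def refTri : Set (Fin 2 → ℝ) := {y | 0 ≤ y 0 ∧ 0 ≤ y 1 ∧ y 0 + y 1 ≤ 1}

lemma isClosed_refTri : IsClosed refTri :=
  (isClosed_le continuous_const (continuous_apply 0)).inter
    ((isClosed_le continuous_const (continuous_apply 1)).inter
      (isClosed_le ((continuous_apply 0).add (continuous_apply 1)) continuous_const))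

lemma image_triParam_refTri (a b c : Fin 2 → ℝ) : triParam a b c '' refTri = Ktri a b c := by
  apply Set.Subset.antisymm
  · rintro _ ⟨y, ⟨h0, h1, h2⟩, rfl⟩
    have hc : Convex ℝ (Ktri a b c) := convex_convexHull ℝ _
    have hsub : ({a, b, c} : Set (Fin 2 → ℝ)) ⊆ Ktri a b c := subset_convexHull ℝ _
    have h := hc.sum_mem (t := Finset.univ) (w := ![1 - y 0 - y 1, y 0, y 1]) (z := ![a, b, c])
      (by intro i _; fin_cases i <;> simp <;> linarith)
      (by simp [Fin.sum_univ_three]; ring)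
      (by intro i _; apply hsub; fin_cases i <;> simp)
    convert h using 1
    simp [Fin.sum_univ_three, triParam]
    module
  · apply convexHull_min
    · rintro x (rfl | rfl | rfl)
      · exact ⟨![0, 0], by simp [refTri], by simp [triParam]⟩
      · exact ⟨![1, 0], by simp [refTri], by simp [triParam]⟩
      · exact ⟨![0, 1], by simp [refTri], by simp [triParam]⟩
    · rintro _ ⟨y, ⟨hy0, hy1, hy2⟩, rfl⟩ _ ⟨z, ⟨hz0, hz1, hz2⟩, rfl⟩ r s hr hs hrs
      refine ⟨r • y + s • z, ⟨?_, ?_, ?_⟩, ?_⟩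
      · simp only [Pi.add_apply, Pi.smul_apply, smul_eq_mul]; positivity
      · simp only [Pi.add_apply, Pi.smul_apply, smul_eq_mul]; positivity
      · simp only [Pi.add_apply, Pi.smul_apply, smul_eq_mul]
        nlinarith [mul_le_mul_of_nonneg_left hy2 hr, mul_le_mul_of_nonneg_left hz2 hs]
      · obtain rfl : s = 1 - r := by linarith
        simp only [triParam, Pi.add_apply, Pi.smul_apply, smul_eq_mul]
        module

lemma hasFDerivAt_triParam (a b c y : Fin 2 → ℝ) :
    HasFDerivAt (triParam a b c)
      ((ContinuousLinearMap.proj (R := ℝ) (φ := fun _ : Fin 2 => ℝ) 0).smulRight (b - a) +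
        (ContinuousLinearMap.proj (R := ℝ) (φ := fun _ : Fin 2 => ℝ) 1).smulRight (c - a)) y :=
  (((hasFDerivAt_apply (0 : Fin 2) y).smul_const (b - a)).const_add a).add
    ((hasFDerivAt_apply (1 : Fin 2) y).smul_const (c - a))

lemma injective_triParam {a b c : Fin 2 → ℝ}
    (hd : (b 0 - a 0) * (c 1 - a 1) - (b 1 - a 1) * (c 0 - a 0) ≠ 0) :
    Function.Injective (triParam a b c) := by
  intro y z h
  have e0 := congrFun h 0
  have e1 := congrFun h 1
  simp only [triParam, Pi.add_apply, Pi.smul_apply, Pi.sub_apply, smul_eq_mul] at e0 e1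
  refine funext (Fin.forall_fin_two.2 ⟨mul_left_cancel₀ hd ?_, mul_left_cancel₀ hd ?_⟩)
  · linear_combination (c 1 - a 1) * e0 - (c 0 - a 0) * e1
  · linear_combination (b 0 - a 0) * e1 - (b 1 - a 1) * e0

lemma setIntegral_Ktri_eq_zero {a b c : Fin 2 → ℝ}
    (hd : (b 0 - a 0) * (c 1 - a 1) - (b 1 - a 1) * (c 0 - a 0) ≠ 0) {f : (Fin 2 → ℝ) → ℝ}
    (h : ∫ y in refTri, f (triParam a b c y) = 0) : ∫ x in Ktri a b c, f x = 0 := by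
  rw [← image_triParam_refTri, integral_image_eq_integral_abs_det_fderiv_smul volume
    isClosed_refTri.measurableSet (fun y _ => (hasFDerivAt_triParam a b c y).hasFDerivWithinAt)
    (injective_triParam hd).injOn, integral_smul, h, smul_zero]

lemma setIntegral_refTri_eq_zero {f F : ℝ → ℝ → ℝ} (hf : Continuous fun z : ℝ × ℝ => f z.1 z.2)
    (hF : ∀ s r, HasDerivAt (fun s => F s r) (f s r) s)
    (h0 : ∀ r, F 0 r = 0) (h1 : ∀ r, F (1 - r) r = 0) :
    ∫ y in refTri, f (y 0) (y 1) = 0 := by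
  let T : Set (ℝ × ℝ) := {z | 0 ≤ z.1 ∧ 0 ≤ z.2 ∧ z.1 + z.2 ≤ 1}
  have hTc : IsClosed T :=
    (isClosed_le continuous_const continuous_fst).inter
      ((isClosed_le continuous_const continuous_snd).inter
        (isClosed_le (continuous_fst.add continuous_snd) continuous_const))
  have hTcomp : IsCompact T := by
    refine (isCompact_Icc (a := ((0, 0) : ℝ × ℝ)) (b := (1, 1))).of_isClosed_subset hTc ?_
    rintro ⟨s, r⟩ ⟨hs, hr, hsr⟩
    simp only at hs hr hsr
    exact ⟨⟨hs, hr⟩, ⟨by simp only; linarith, by simp only; linarith⟩⟩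
  have e := (volume_preserving_finTwoArrow ℝ).setIntegral_preimage_emb
    (MeasurableEquiv.measurableEmbedding _) (fun z : ℝ × ℝ => f z.1 z.2) T
  refine e.trans ?_
  have hint : Integrable (T.indicator fun z : ℝ × ℝ => f z.1 z.2) :=
    (hf.continuousOn.integrableOn_compact hTcomp).integrable_indicator hTc.measurableSet
  rw [← integral_indicator hTc.measurableSet, Measure.volume_eq_prod,
    integral_prod_symm _ (by rwa [Measure.volume_eq_prod] at hint)]
  refine integral_eq_zero_of_ae (Filter.Eventually.of_forall fun r => ?_)
  simp only [Pi.zero_apply]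
  by_cases hr : 0 ≤ r ∧ r ≤ 1
  · have hslice : (fun s => T.indicator (fun z : ℝ × ℝ => f z.1 z.2) (s, r)) =
        (Set.Icc 0 (1 - r)).indicator fun s => f s r := by
      funext s
      by_cases hs : s ∈ Set.Icc 0 (1 - r)
      · rw [Set.indicator_of_mem hs, Set.indicator_of_mem]
        exact ⟨hs.1, hr.1, by have := hs.2; simp only; linarith⟩
      · rw [Set.indicator_of_notMem hs, Set.indicator_of_notMem]
        rintro ⟨h1, -, h2⟩
        exact hs ⟨h1, by simp only at h2; linarith⟩
    rw [hslice, integral_indicator measurableSet_Icc, integral_Icc_eq_integral_Ioc,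
      ← intervalIntegral.integral_of_le (by linarith [hr.2]),
      intervalIntegral.integral_eq_sub_of_hasDerivAt (fun s _ => hF s r)
        ((hf.comp (Continuous.prodMk_left r)).intervalIntegrable _ _), h0, h1, sub_zero]
  · refine integral_eq_zero_of_ae (Filter.Eventually.of_forall fun s => ?_)
    rw [Pi.zero_apply]
    apply Set.indicator_of_notMem
    rintro ⟨h1, h2, h3⟩
    simp only at h1 h2 h3
    exact hr ⟨h2, by linarith⟩

/-- The derivative along the edge `ab` of a polynomial that vanishes on the lines `ac` and `bc`
integrates to zero over the triangle `abc`. -/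
lemma triIntegral_dirDeriv_eq_zero {a b c : Fin 2 → ℝ}
    (hd : (b 0 - a 0) * (c 1 - a 1) - (b 1 - a 1) * (c 0 - a 0) ≠ 0)
    {G : MvPolynomial (Fin 2) ℝ} (hac : ∀ r : ℝ, MvPolynomial.eval (a + r • (c - a)) G = 0)
    (hbc : ∀ r : ℝ, MvPolynomial.eval (b + r • (c - b)) G = 0) :
    triIntegral a b c (dirDeriv (b - a) G) = 0 := by
  apply setIntegral_Ktri_eq_zero hd
  have hsmooth : Continuous fun z : ℝ × ℝ => a + z.1 • (b - a) + z.2 • (c - a) := by fun_prop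
  refine setIntegral_refTri_eq_zero
    (f := fun s r => MvPolynomial.eval (a + s • (b - a) + r • (c - a)) (dirDeriv (b - a) G))
    (F := fun s r => MvPolynomial.eval (a + s • (b - a) + r • (c - a)) G)
    ((MvPolynomial.continuous_eval _).comp hsmooth) (fun s r => ?_) (fun r => ?_) (fun r => ?_)
  · have hline : HasDerivAt (fun s : ℝ => a + s • (b - a) + r • (c - a)) (b - a) s := by
      simpa using (((hasDerivAt_id s).smul_const (b - a)).const_add a).add_const (r • (c - a))
    refine ((hasFDerivAt_eval G _).comp_hasDerivAt s hline).congr_deriv ?_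
    simp [dirDeriv_apply]
    ring
  · simpa using hac r
  · rw [show a + (1 - r) • (b - a) + r • (c - a) = b + r • (c - b) by module]
    exact hbc r

lemma interior_Ktri_nonempty {a b c : Fin 2 → ℝ} (h : AffineIndependent ℝ ![a, b, c]) :
    (interior (Ktri a b c)).Nonempty := by
  have h1 := (interior_convexHull_nonempty_iff_affineSpan_eq_top (s := Set.range ![a, b, c])).2
    (h.affineSpan_eq_top_iff_card_eq_finrank_add_one.2 (by simp))
  have h2 : Set.range ![a, b, c] = {a, b, c} := by
    simp only [Matrix.range_cons, Matrix.range_empty, Set.union_empty, Set.singleton_union]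
  rwa [h2] at h1

lemma triIntegral_nonneg {a b c : Fin 2 → ℝ} {p : MvPolynomial (Fin 2) ℝ}
    (hp : ∀ x ∈ Ktri a b c, 0 ≤ MvPolynomial.eval x p) : 0 ≤ triIntegral a b c p :=
  setIntegral_nonneg (isCompact_Ktri a b c).measurableSet hp

lemma eq_zero_of_triIntegral_eq_zero {a b c : Fin 2 → ℝ} (h : AffineIndependent ℝ ![a, b, c])
    {p : MvPolynomial (Fin 2) ℝ} (hp : ∀ x ∈ Ktri a b c, 0 ≤ MvPolynomial.eval x p)
    (hp0 : triIntegral a b c p = 0) : p = 0 := by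
  have h1 := (setIntegral_eq_zero_iff_of_nonneg_ae
    (ae_restrict_of_forall_mem (isCompact_Ktri a b c).measurableSet hp)
    (integrableOn_eval_Ktri a b c p)).1 hp0
  have h2 := Measure.eqOn_open_of_ae_eq (ae_restrict_of_ae_restrict_of_subset interior_subset h1)
    isOpen_interior (MvPolynomial.continuous_eval p).continuousOn continuousOn_const
  exact eq_zero_of_eval_eq_zero_on_open isOpen_interior (interior_Ktri_nonempty h) h2

lemma nonneg_of_mem_Ktri {a b c : Fin 2 → ℝ} {f : (Fin 2 → ℝ) → ℝ} (hf : IsAffineFn f)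
    (ha : 0 ≤ f a) (hb : 0 ≤ f b) (hc : 0 ≤ f c) {x : Fin 2 → ℝ} (hx : x ∈ Ktri a b c) :
    0 ≤ f x := by
  obtain ⟨w, e, hw⟩ := hf
  suffices h : Ktri a b c ⊆ {y | 0 ≤ f y} from h hx
  refine convexHull_min ?_ fun y hy z hz r s hr hs hrs => ?_
  · rintro y (rfl | rfl | rfl) <;> assumption
  · have e1 : f (r • y + s • z) = r * f y + s * f z := by
      obtain rfl : s = 1 - r := by linarith
      simp only [hw, Pi.add_apply, Pi.smul_apply, smul_eq_mul]
      ring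
    rw [Set.mem_ofPred_eq, e1]
    exact add_nonneg (mul_nonneg hr hy) (mul_nonneg hs hz)

/-- An affine function that vanishes at two points vanishes on the line through them. -/
lemma IsAffineFn.eq_zero_on_line {f : (Fin 2 → ℝ) → ℝ} (hf : IsAffineFn f) {a c : Fin 2 → ℝ}
    (ha : f a = 0) (hc : f c = 0) (r : ℝ) : f (a + r • (c - a)) = 0 := by
  obtain ⟨w, e, hw⟩ := hf
  simp only [hw, Pi.add_apply, Pi.smul_apply, Pi.sub_apply, smul_eq_mul] at *
  linear_combination (1 - r) * ha + r * hc

lemma IsAffineFn.exists_poly {f : (Fin 2 → ℝ) → ℝ} (hf : IsAffineFn f) :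
    ∃ L : MvPolynomial (Fin 2) ℝ, (∀ x, MvPolynomial.eval x L = f x) ∧ L.totalDegree ≤ 1 := by
  obtain ⟨w, e, hw⟩ := hf
  refine ⟨w 0 • MvPolynomial.X 0 + w 1 • MvPolynomial.X 1 + MvPolynomial.C e,
    fun x => by simp [hw], ?_⟩
  rw [← MvPolynomial.mem_restrictTotalDegree]
  refine add_mem (add_mem (Submodule.smul_mem _ _ ?_) (Submodule.smul_mem _ _ ?_)) ?_ <;>
    simp [MvPolynomial.mem_restrictTotalDegree]

lemma det_ne_zero_of_affine {a b c : Fin 2 → ℝ} {f g : (Fin 2 → ℝ) → ℝ} (hf : IsAffineFn f)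
    (hg : IsAffineFn g) (hfa : f a = 0) (hfb : f b = 1) (hfc : f c = 0)
    (hga : g a = 0) (hgb : g b = 0) (hgc : g c = 1) :
    (b 0 - a 0) * (c 1 - a 1) - (b 1 - a 1) * (c 0 - a 0) ≠ 0 := by
  obtain ⟨w, e, hw⟩ := hf
  obtain ⟨w', e', hw'⟩ := hg
  rw [hw] at hfa hfb hfc
  rw [hw'] at hga hgb hgc
  intro h
  have e1 : w 0 * (b 0 - a 0) + w 1 * (b 1 - a 1) = 1 := by linarith
  have e2 : w 0 * (c 0 - a 0) + w 1 * (c 1 - a 1) = 0 := by linarith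
  have e3 : w' 0 * (b 0 - a 0) + w' 1 * (b 1 - a 1) = 0 := by linarith
  have e4 : w' 0 * (c 0 - a 0) + w' 1 * (c 1 - a 1) = 1 := by linarith
  have : (1 : ℝ) = 0 := by
    linear_combination (w 0 * w' 1 - w 1 * w' 0) * h - e4
      - (w' 0 * (c 0 - a 0) + w' 1 * (c 1 - a 1)) * e1
      + (w' 0 * (b 0 - a 0) + w' 1 * (b 1 - a 1)) * e2
  exact one_ne_zero this

lemma perp_nvec (x0 x1 x2 : Fin 2 → ℝ) :
    perp (nvec x0 x1 x2 0) = (Bmat x0 x1 x2).det⁻¹ • (x1 - x2) ∧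
    perp (nvec x0 x1 x2 1) = (Bmat x0 x1 x2).det⁻¹ • (x2 - x0) ∧
    perp (nvec x0 x1 x2 2) = (Bmat x0 x1 x2).det⁻¹ • (x0 - x1) := by
  have h : (Bmat x0 x1 x2)⁻¹ = (Bmat x0 x1 x2).det⁻¹ • (Bmat x0 x1 x2).adjugate := by
    rw [Matrix.inv_def, Ring.inverse_eq_inv']
  generalize (Bmat x0 x1 x2).det⁻¹ = d at h ⊢
  simp only [perp, nvec, h]
  refine ⟨?_, ?_, ?_⟩ <;> refine funext (Fin.forall_fin_two.2 ⟨?_, ?_⟩) <;>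
    simp [Matrix.adjugate_fin_two, Bmat] <;> ring

/-- The divergence of a bubble stress is the polynomial bubble divergence. -/
lemma matDiv_bubbleStress {x0 x1 x2 : Fin 2 → ℝ} {lam p : Fin 3 → (Fin 2 → ℝ) → ℝ}
    {L q : Fin 3 → MvPolynomial (Fin 2) ℝ} (hL : ∀ i x, MvPolynomial.eval x (L i) = lam i x)
    (hq : ∀ i x, p i x = MvPolynomial.eval x (q i)) (x : Fin 2 → ℝ) (i : Fin 2) :
    matDiv (bubbleStress x0 x1 x2 lam p) x i =
      MvPolynomial.eval x (bubbleDiv (fun l => perp (nvec x0 x1 x2 l))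
        ![L 1 * L 2, L 2 * L 0, L 0 * L 1] q i) := by
  have h (j : Fin 2) : (fun y => bubbleStress x0 x1 x2 lam p y i j) = fun y =>
      MvPolynomial.eval y (∑ l, (perp (nvec x0 x1 x2 l) i * perp (nvec x0 x1 x2 l) j) •
        ((![L 1 * L 2, L 2 * L 0, L 0 * L 1] : Fin 3 → MvPolynomial (Fin 2) ℝ) l * q l)) := by
    funext y
    simp [bubbleStress, vvT, Fin.sum_univ_three, hL, hq]
    ring
  simp only [matDiv, h, pd_eval]
  simp only [bubbleDiv_apply, dirDeriv_apply, map_add, Derivation.map_smul,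
    MvPolynomial.smul_eval, Fin.sum_univ_three]
  ring

lemma isPolyDeg_natCast_iff {m : ℕ} {f : (Fin 2 → ℝ) → ℝ} :
    IsPolyDeg m f ↔ ∃ p : MvPolynomial (Fin 2) ℝ,
      (∀ x, f x = MvPolynomial.eval x p) ∧ p.totalDegree ≤ m := by
  refine exists_congr fun p => and_congr_right fun _ => ?_
  rw [Nat.cast_le, or_iff_left_of_imp]
  rintro rfl
  simp

/-- Integration by parts for the bubble functions of a triangle. -/
lemma triIntegral_dirDeriv_bubble {x0 x1 x2 a b c : Fin 2 → ℝ} {La Lb : MvPolynomial (Fin 2) ℝ}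
    {la lb : (Fin 2 → ℝ) → ℝ} (hK : Ktri a b c = Ktri x0 x1 x2)
    (hLa : ∀ x, MvPolynomial.eval x La = la x) (hLb : ∀ x, MvPolynomial.eval x Lb = lb x)
    (hla : IsAffineFn la) (hlb : IsAffineFn lb)
    (hab : la b = 0) (hac : la c = 0)
    (hba : lb a = 0) (hbc : lb c = 0)
    (hd : (b 0 - a 0) * (c 1 - a 1) - (b 1 - a 1) * (c 0 - a 0) ≠ 0)
    (r : ℝ) (q : MvPolynomial (Fin 2) ℝ) :
    triIntegral x0 x1 x2 (dirDeriv (r • (b - a)) (La * Lb * q)) = 0 := by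
  have h : triIntegral a b c (dirDeriv (b - a) (La * Lb * q)) = 0 := by
    apply triIntegral_dirDeriv_eq_zero hd
    · intro s
      simp [hLb, hlb.eq_zero_on_line hba hbc]
    · intro s
      simp [hLa, hla.eq_zero_on_line hab hac]
  rw [triIntegral_apply, hK, ← triIntegral_apply] at h
  rw [dirDeriv_smul, map_smul, h, smul_zero]

theorem stmt_10 (k : ℕ) (hk : 2 ≤ k)
    (x0 x1 x2 : Fin 2 → ℝ)
    (hind : AffineIndependent ℝ ![x0, x1, x2])
    (lam : Fin 3 → (Fin 2 → ℝ) → ℝ)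
    (hlam_aff : ∀ i, IsAffineFn (lam i))
    (hlam_val : ∀ i j : Fin 3, lam i (![x0, x1, x2] j) = if i = j then 1 else 0) :
    {v | ∃ τ, SigmaKb k x0 x1 x2 lam τ ∧ matDiv τ = v} =
      {v : (Fin 2 → ℝ) → Fin 2 → ℝ |
        (∀ i, IsPolyDeg ((k : ℤ) - 1) (fun x => v x i)) ∧
        ∀ r, IsRigidMotion r →
          ∫ x in Ktri x0 x1 x2, ∑ i : Fin 2, v x i * r x i = 0} ∧
    ∀ v : (Fin 2 → ℝ) → Fin 2 → ℝ,
      (∀ i, IsPolyDeg ((k : ℤ) - 1) (fun x => v x i)) →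
      (∀ r, IsRigidMotion r →
        ∫ x in Ktri x0 x1 x2, ∑ i : Fin 2, v x i * r x i = 0) →
      ∃ p : Fin 3 → (Fin 2 → ℝ) → ℝ,
        (∀ i, IsPolyDeg ((k : ℤ) - 2) (p i)) ∧
        ∀ x, matDiv (bubbleStress x0 x1 x2 lam p) x = v x := by
  obtain ⟨m, rfl⟩ := Nat.exists_eq_add_of_le' hk
  have hm2 : ((m + 2 : ℕ) : ℤ) - 2 = (m : ℕ) := by push_cast; ring
  have hm1 : ((m + 2 : ℕ) : ℤ) - 1 = ((m + 1 : ℕ) : ℤ) := by push_cast; ring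
  simp only [hm2, hm1, isPolyDeg_natCast_iff]
  have val (i : Fin 3) : lam i x0 = (if i = 0 then 1 else 0) ∧
      lam i x1 = (if i = 1 then 1 else 0) ∧ lam i x2 = (if i = 2 then 1 else 0) :=
    ⟨hlam_val i 0, hlam_val i 1, hlam_val i 2⟩
  obtain ⟨v00, v01, v02⟩ := val 0
  obtain ⟨v10, v11, v12⟩ := val 1
  obtain ⟨v20, v21, v22⟩ := val 2
  simp only [Fin.isValue, Fin.reduceEq, if_true, if_false] at v00 v01 v02 v10 v11 v12 v20 v21 v22
  choose L hL hLdeg using fun i => (hlam_aff i).exists_poly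
  have hd := det_ne_zero_of_affine (hlam_aff 1) (hlam_aff 2) v10 v11 v12 v20 v21 v22
  have hdB : (Bmat x0 x1 x2).det =
      (x1 0 - x0 0) * (x2 1 - x0 1) - (x1 1 - x0 1) * (x2 0 - x0 0) := by
    simp [Matrix.det_fin_two, Bmat]
    ring
  obtain ⟨t0, t1, t2⟩ := perp_nvec x0 x1 x2
  set t : Fin 3 → Fin 2 → ℝ := fun l => perp (nvec x0 x1 x2 l) with ht
  set φ : Fin 3 → MvPolynomial (Fin 2) ℝ := ![L 1 * L 2, L 2 * L 0, L 0 * L 1]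
  have ibp (l : Fin 3) (q : MvPolynomial (Fin 2) ℝ) :
      triIntegral x0 x1 x2 (dirDeriv (t l) (φ l * q)) = 0 := by
    fin_cases l
    · change triIntegral x0 x1 x2 (dirDeriv (perp (nvec x0 x1 x2 0)) (L 1 * L 2 * q)) = 0
      rw [t0, mul_comm (L 1)]
      refine triIntegral_dirDeriv_bubble (c := x0) ?_ (hL 2) (hL 1) (hlam_aff 2) (hlam_aff 1)
        v21 v20 v12 v10 (fun h => hd ?_) _ q
      · rw [Ktri, Ktri, Set.pair_comm x1 x0, Set.insert_comm x2 x0, Set.pair_comm x2 x1]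
      · linear_combination -h
    · change triIntegral x0 x1 x2 (dirDeriv (perp (nvec x0 x1 x2 1)) (L 2 * L 0 * q)) = 0
      rw [t1, mul_comm (L 2)]
      refine triIntegral_dirDeriv_bubble (c := x1) ?_ (hL 0) (hL 2) (hlam_aff 0) (hlam_aff 2)
        v02 v01 v20 v21 (fun h => hd ?_) _ q
      · rw [Ktri, Ktri, Set.pair_comm x2 x1]
      · linear_combination -h
    · change triIntegral x0 x1 x2 (dirDeriv (perp (nvec x0 x1 x2 2)) (L 0 * L 1 * q)) = 0
      rw [t2, mul_comm (L 0)]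
      refine triIntegral_dirDeriv_bubble (c := x2) ?_ (hL 1) (hL 0) (hlam_aff 1) (hlam_aff 0)
        v10 v12 v01 v02 (fun h => hd ?_) _ q
      · rw [Ktri, Ktri, Set.insert_comm x1 x0]
      · linear_combination -h
  have lam_nonneg (i : Fin 3) {x : Fin 2 → ℝ} (hx : x ∈ Ktri x0 x1 x2) : 0 ≤ lam i x := by
    refine nonneg_of_mem_Ktri (hlam_aff i) ?_ ?_ ?_ hx
    · rw [(val i).1]; split_ifs <;> norm_num
    · rw [(val i).2.1]; split_ifs <;> norm_num
    · rw [(val i).2.2]; split_ifs <;> norm_num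
  have L_ne_zero (i : Fin 3) : L i ≠ 0 := by
    intro h
    have := hlam_val i i
    rw [← hL, h, map_zero, if_pos rfl] at this
    exact zero_ne_one this
  have φ_ne_zero (l : Fin 3) : φ l ≠ 0 := by
    fin_cases l <;> exact mul_ne_zero (L_ne_zero _) (L_ne_zero _)
  have φ_deg (l : Fin 3) : (φ l).totalDegree ≤ 2 := by
    have h (i j : Fin 3) : (L i * L j).totalDegree ≤ 2 :=
      (MvPolynomial.totalDegree_mul _ _).trans (add_le_add (hLdeg i) (hLdeg j))
    fin_cases l <;> exact h _ _
  have φ_nonneg (l : Fin 3) (p : MvPolynomial (Fin 2) ℝ) (x) (hx : x ∈ Ktri x0 x1 x2) :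
      0 ≤ MvPolynomial.eval x (φ l * p ^ 2) := by
    rw [map_mul, map_pow]
    refine mul_nonneg ?_ (sq_nonneg _)
    have h (i j : Fin 3) : 0 ≤ MvPolynomial.eval x (L i * L j) := by
      rw [map_mul, hL, hL]
      exact mul_nonneg (lam_nonneg i hx) (lam_nonneg j hx)
    fin_cases l <;> exact h _ _
  have sq_eval_nonneg (p : MvPolynomial (Fin 2) ℝ) (x) (_ : x ∈ Ktri x0 x1 x2) :
      0 ≤ MvPolynomial.eval x (p ^ 2) := by
    rw [map_pow]
    exact sq_nonneg _
  have integral_eq {v r : (Fin 2 → ℝ) → Fin 2 → ℝ} {V R : Fin 2 → MvPolynomial (Fin 2) ℝ}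
      (hV : ∀ i x, v x i = MvPolynomial.eval x (V i))
      (hR : ∀ i x, r x i = MvPolynomial.eval x (R i)) :
      ∫ x in Ktri x0 x1 x2, ∑ i : Fin 2, v x i * r x i =
        fieldForm (triIntegral x0 x1 x2) V R := by
    simp [fieldForm_apply, triIntegral_apply, Fin.sum_univ_two, hV, hR]
  have rigid_eval (a b c : ℝ) (i : Fin 2) (x : Fin 2 → ℝ) :
      (![a - b * x 1, c + b * x 0] : Fin 2 → ℝ) i =
        MvPolynomial.eval x (rigidPoly a b c i) := by
    fin_cases i <;> simp [rigidPoly]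
  have surj (v : (Fin 2 → ℝ) → Fin 2 → ℝ)
      (hv : ∀ i, ∃ p : MvPolynomial (Fin 2) ℝ,
        (∀ x, v x i = MvPolynomial.eval x p) ∧ p.totalDegree ≤ m + 1)
      (hvr : ∀ r, IsRigidMotion r →
        ∫ x in Ktri x0 x1 x2, ∑ i : Fin 2, v x i * r x i = 0) :
      ∃ p : Fin 3 → (Fin 2 → ℝ) → ℝ,
        (∀ i, ∃ q : MvPolynomial (Fin 2) ℝ,
          (∀ x, p i x = MvPolynomial.eval x q) ∧ q.totalDegree ≤ m) ∧
        ∀ x, matDiv (bubbleStress x0 x1 x2 lam p) x = v x := by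
    choose V hV hVdeg using hv
    obtain ⟨q, hqdeg, hq⟩ := exists_bubbleDiv_eq (m := m) ibp φ_deg
      (fun l p => triIntegral_nonneg (φ_nonneg l p))
      (fun l p h => pow_eq_zero_iff two_ne_zero |>.1 <| (mul_eq_zero.1
        (eq_zero_of_triIntegral_eq_zero hind (φ_nonneg l p) h)).resolve_left (φ_ne_zero l))
      (fun p => triIntegral_nonneg (sq_eval_nonneg p))
      (fun p h => pow_eq_zero_iff two_ne_zero |>.1 <|
        eq_zero_of_triIntegral_eq_zero hind (sq_eval_nonneg p) h)
      (by
        simp only [ht, t1, t2, Pi.smul_apply, Pi.sub_apply, smul_eq_mul]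
        rw [← hdB] at hd
        have hne := mul_ne_zero (pow_ne_zero 2 (inv_ne_zero hd)) hd
        intro h
        apply hne
        nth_rewrite 2 [hdB]
        linear_combination h)
      (by simp only [ht, t0, t1, t2]; module)
      hVdeg
      (fun a b c => by
        rw [← integral_eq (r := fun x => ![a - b * x 1, c + b * x 0]) hV (rigid_eval a b c)]
        exact hvr _ ⟨a, b, c, fun _ => rfl⟩)
    refine ⟨fun i x => MvPolynomial.eval x (q i), fun i => ⟨q i, fun _ => rfl, hqdeg i⟩,
      fun x => funext fun i => ?_⟩
    rw [matDiv_bubbleStress hL (fun _ _ => rfl), hV, ← hq]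
  refine ⟨Set.Subset.antisymm ?_ ?_, surj⟩
  · rintro _ ⟨_, ⟨p, hp, rfl⟩, rfl⟩
    simp only [hm2, isPolyDeg_natCast_iff] at hp
    choose q hq hqdeg using hp
    have hV (i : Fin 2) (x : Fin 2 → ℝ) :=
      matDiv_bubbleStress (x0 := x0) (x1 := x1) (x2 := x2) hL hq x i
    refine ⟨fun i => ⟨_, hV i, totalDegree_bubbleDiv_le _ φ_deg hqdeg i⟩, ?_⟩
    rintro r ⟨a, b, c, hr⟩
    rw [integral_eq hV (fun i x => (congrFun (hr x) i).trans (rigid_eval a b c i x))]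
    exact fieldForm_bubbleDiv_rigidPoly ibp q a b c
  · rintro v ⟨hv, hvr⟩
    obtain ⟨p, hp, hpv⟩ := surj v hv hvr
    refine ⟨_, ⟨p, fun i => ?_, rfl⟩, funext hpv⟩
    rw [hm2, isPolyDeg_natCast_iff]
    exact hp i
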